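/- Let E be a finite-dimensional real inner product space, D ⊆ E a nonempty compact convex set, and f : E → ℝ continuously differentiable with L-Lipschitz gradient (for some L ≥ 0). Let step sizes α : ℕ → ℝ satisfy 0 ≤ α n ≤ 1, Σ_n α n = ∞, and Σ_n (α n)² < ∞. Let x 0 ∈ D, and for each n let d n ∈ D be a minimizer over D of y ↦ ⟪∇f(x n), y⟫, with x (n+1) = x n + α n • (d n − x n). Then lim inf_{n → ∞} ⟪∇f(x n), x n − d n⟫ = 0, i.e., the Frank–Wolfe gap vanishes along a subsequence. -/

import Mathlib

open Filter
open scoped RealInnerProductSpace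

theorem fw_descent {E : Type*} [NormedAddCommGroup E] [InnerProductSpace ℝ E]
    [FiniteDimensional ℝ E] (f : E → ℝ) (hf : ContDiff ℝ 1 f)
    (L : ℝ) (hL : 0 ≤ L)
    (hlip : LipschitzWith L.toNNReal (fun x => gradient f x)) (x v : E) :
    f (x + v) ≤ f x + ⟪gradient f x, v⟫ + L * ‖v‖ ^ 2 := by
  have hd : Differentiable ℝ f := hf.differentiable (by norm_num)
  have hder : ∀ t : ℝ, HasDerivAt (fun t : ℝ => f (x + t • v))
      ⟪gradient f (x + t • v), v⟫ t := by
    intro t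
    have h1 : HasDerivAt (fun t : ℝ => x + t • v) v t := by
      simpa using ((hasDerivAt_id t).smul_const v).const_add x
    have h2 := (hd (x + t • v)).hasGradientAt.hasFDerivAt
    have h3 := h2.comp_hasDerivAt t h1
    rw [InnerProductSpace.toDual_apply_apply] at h3
    exact h3
  obtain ⟨c, hc, he⟩ := exists_hasDerivAt_eq_slope (fun t : ℝ => f (x + t • v)) _ zero_lt_one
    (fun t _ => (hder t).continuousAt.continuousWithinAt) (fun t _ => hder t)
  simp only [one_smul, zero_smul, add_zero, sub_zero, div_one] at he
  have h3 : ‖gradient f (x + c • v) - gradient f x‖ ≤ L * ‖v‖ := by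
    have h := hlip.dist_le_mul (x + c • v) x
    rw [Real.coe_toNNReal L hL, dist_eq_norm, dist_eq_norm, add_sub_cancel_left, norm_smul,
      Real.norm_of_nonneg hc.1.le] at h
    refine h.trans (mul_le_mul_of_nonneg_left ?_ hL)
    exact mul_le_of_le_one_left (norm_nonneg _) hc.2.le
  have h4 : ⟪gradient f (x + c • v) - gradient f x, v⟫ ≤ L * ‖v‖ * ‖v‖ :=
    (real_inner_le_norm _ _).trans (mul_le_mul_of_nonneg_right h3 (norm_nonneg _))
  rw [inner_sub_left] at h4
  nlinarith

/-- **Vanishing Frank–Wolfe gap.** For the Frank–Wolfe method with diminishing step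
sizes (`∑ α n = ∞`, `∑ (α n)² < ∞`) on a nonempty compact convex set `D`, applied to
a `C¹` function `f` with `L`-Lipschitz gradient, the Frank–Wolfe gap
`⟪∇f(x n), x n − d n⟫` has `liminf` equal to `0`. -/
theorem frank_wolfe_gap_vanishes
    {E : Type*} [NormedAddCommGroup E] [InnerProductSpace ℝ E] [FiniteDimensional ℝ E]
    (D : Set E) (hDne : D.Nonempty) (hDcomp : IsCompact D) (hDconv : Convex ℝ D)
    (f : E → ℝ) (hf : ContDiff ℝ 1 f)
    (L : ℝ) (hL : 0 ≤ L)
    (hlip : LipschitzWith L.toNNReal (fun x => gradient f x))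
    (α : ℕ → ℝ) (hα0 : ∀ n, 0 ≤ α n) (hα1 : ∀ n, α n ≤ 1)
    (hαdiv : Tendsto (fun N => ∑ n ∈ Finset.range N, α n) atTop atTop)
    (hαsq : Summable (fun n => (α n) ^ 2))
    (x d : ℕ → E) (hx0 : x 0 ∈ D)
    (hdmem : ∀ n, d n ∈ D)
    (hdmin : ∀ n, ∀ y ∈ D, ⟪gradient f (x n), d n⟫ ≤ ⟪gradient f (x n), y⟫)
    (hupd : ∀ n, x (n + 1) = x n + α n • (d n - x n)) :
    liminf (fun n => ⟪gradient f (x n), x n - d n⟫) atTop = 0 := by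
  have hxD : ∀ n, x n ∈ D := by
    intro n
    induction n with
    | zero => exact hx0
    | succ n ih =>
      rw [hupd]
      exact hDconv.add_smul_sub_mem ih (hdmem n) ⟨hα0 n, hα1 n⟩
  have hgap : ∀ n, 0 ≤ ⟪gradient f (x n), x n - d n⟫ := by
    intro n
    rw [inner_sub_right]
    linarith [hdmin n _ (hxD n)]
  obtain ⟨m, hm⟩ := (hDcomp.image hf.continuous).bddBelow
  have hm' : ∀ n, m ≤ f (x n) := fun n => hm ⟨_, hxD n, rfl⟩
  obtain ⟨R, hR⟩ := Metric.isBounded_iff.1 hDcomp.isBounded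
  have hstep : ∀ n, f (x (n + 1)) ≤ f (x n) - α n * ⟪gradient f (x n), x n - d n⟫
      + L * R ^ 2 * α n ^ 2 := by
    intro n
    have h := fw_descent f hf L hL hlip (x n) (α n • (d n - x n))
    rw [← hupd, inner_smul_right, norm_smul, Real.norm_of_nonneg (hα0 n),
      ← neg_sub (x n) (d n), inner_neg_right, norm_neg, mul_pow] at h
    have hr : ‖x n - d n‖ ≤ R := by
      rw [← dist_eq_norm]; exact hR (hxD n) (hdmem n)
    have hr2 : ‖x n - d n‖ ^ 2 ≤ R ^ 2 := pow_le_pow_left₀ (norm_nonneg _) hr 2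
    have h5 : L * (α n ^ 2 * ‖x n - d n‖ ^ 2) ≤ L * (α n ^ 2 * R ^ 2) := by gcongr
    linarith
  have hfreq : ∀ ε : ℝ, 0 < ε → ∃ᶠ n in atTop, ⟪gradient f (x n), x n - d n⟫ ≤ ε := by
    intro ε hε hcon
    obtain ⟨N, hN⟩ := eventually_atTop.1 hcon
    have hC : 0 ≤ L * R ^ 2 := by positivity
    have hmono : ∀ n ≥ N, f (x n) + ε * (∑ k ∈ Finset.range n, α k)
        - L * R ^ 2 * (∑ k ∈ Finset.range n, α k ^ 2) ≤
        f (x N) + ε * (∑ k ∈ Finset.range N, α k)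
        - L * R ^ 2 * (∑ k ∈ Finset.range N, α k ^ 2) := by
      intro n hn
      induction n, hn using Nat.le_induction with
      | base => exact le_rfl
      | succ n hn ih =>
        rw [Finset.sum_range_succ, Finset.sum_range_succ]
        have h1 := hstep n
        have h2 := mul_le_mul_of_nonneg_left (not_le.1 (hN n hn)).le (hα0 n)
        linarith
    set V := f (x N) + ε * (∑ k ∈ Finset.range N, α k)
        - L * R ^ 2 * (∑ k ∈ Finset.range N, α k ^ 2)
    obtain ⟨n, hn1, hn2⟩ := ((hαdiv.eventually_gt_atTop
      ((V + L * R ^ 2 * (∑' k, α k ^ 2) - m) / ε)).and (eventually_ge_atTop N)).exists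
    rw [div_lt_iff₀ hε] at hn1
    have h1 := hmono n hn2
    have h2 := mul_le_mul_of_nonneg_left
      (hαsq.sum_le_tsum (Finset.range n) (fun k _ => sq_nonneg (α k))) hC
    linarith [hm' n]
  apply le_antisymm
  · refine le_of_forall_pos_le_add fun ε hε => ?_
    rw [zero_add]
    exact liminf_le_of_frequently_le (hfreq ε hε) ⟨0, eventually_map.2 (.of_forall hgap)⟩
  · exact le_liminf_of_le (IsCoboundedUnder.of_frequently_le (hfreq 1 one_pos)) (.of_forall hgap)
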